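/- arXiv:2205.07813 — 2 statements merged into one kernel-verified Lean document; each statement's English description precedes it below -/
import Mathlib

section
/- (Deterministic core of the Slope oracle inequality.) Let d ≥ 1, T > 0, κ_min > 0, κ_max > 0, c* > 0, ε₀ ∈ (0,1), and let c_S ≥ c*·√(κ_max). Let Σ ∈ ℝ^{d×d} be invertible, Ĉ ∈ ℝ^{d×d} symmetric positive semidefinite, ε, A₀ ∈ ℝ^{d×d}, and let s := ‖Σ⁻¹A₀‖₀ with 1 ≤ s ≤ d². Assume: (i) tr(B Ĉ Bᵀ) ≥ (κ_min/2)‖B‖₂² for all B ∈ ℝ^{d×d}; (ii) ⟨ε, B⟩₂ ≤ c*·√(κ_max/T)·max(‖B‖_*, √(log(4/ε₀))·‖B‖₂) for all B ∈ ℝ^{d×d}. Let Â minimize A ↦ L(A) + (2c_S/√T)·‖Σ⁻¹A‖_* over ℝ^{d×d}. Then for every A ∈ ℝ^{d×d} with ‖Σ⁻¹A‖₀ ≤ s: Q(Â − A₀) + (2c_S/√T)·‖Σ⁻¹(Â − A)‖_* ≤ Q(A − A₀) + (32·c_S²·s·log(2e·d²/s)/(T·κ_min))·max(1, log(4/ε₀)/(s·log(2e·d²/s))).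 -/
open Matrix Finset

/-- Frobenius norm of a real matrix. -/
noncomputable def frobNorm {d : ℕ} (B : Matrix (Fin d) (Fin d) ℝ) : ℝ :=
  Real.sqrt (∑ i, ∑ j, (B i j) ^ 2)

/-- Trace inner product `⟨B₁, B₂⟩₂ = tr(B₁ᵀ B₂)`. -/
noncomputable def minner {d : ℕ} (B₁ B₂ : Matrix (Fin d) (Fin d) ℝ) : ℝ :=
  Matrix.trace (B₁ᵀ * B₂)

/-- Entrywise ℓ¹ norm of a matrix. -/
noncomputable def l1Norm {d : ℕ} (B : Matrix (Fin d) (Fin d) ℝ) : ℝ :=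
  ∑ i, ∑ j, |B i j|

open Classical in
/-- Number of nonzero entries of a matrix. -/
noncomputable def l0Norm {d : ℕ} (B : Matrix (Fin d) (Fin d) ℝ) : ℕ :=
  (Finset.univ.filter (fun p : Fin d × Fin d => B p.1 p.2 ≠ 0)).card

/-- Nonincreasing rearrangement `b#` of the absolute values of the entries of `b`. -/
noncomputable def sortDesc {N : ℕ} (b : Fin N → ℝ) : Fin N → ℝ :=
  fun j => |b (Tuple.sort (fun i => |b i|) j.rev)|

/-- Slope (weighted sorted-ℓ¹) norm `‖b‖_* = Σ_j √(log(2N/j)) b#_j`. -/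
noncomputable def slopeNorm {N : ℕ} (b : Fin N → ℝ) : ℝ :=
  ∑ j : Fin N, Real.sqrt (Real.log (2 * N / (j.1 + 1))) * sortDesc b j

/-- Slope norm of a matrix, via vectorization (`N = d²`). -/
noncomputable def slopeNormM {d : ℕ} (B : Matrix (Fin d) (Fin d) ℝ) : ℝ :=
  slopeNorm (fun k : Fin (d * d) =>
    B (finProdFinEquiv.symm k).1 (finProdFinEquiv.symm k).2)

/-- `Q(M) = tr(Σ⁻¹ M Ĉ (Σ⁻¹ M)ᵀ)`. -/
noncomputable def Qform {d : ℕ} (S C M : Matrix (Fin d) (Fin d) ℝ) : ℝ :=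
  Matrix.trace (S⁻¹ * M * C * (S⁻¹ * M)ᵀ)

/-- `L(A) = ⟨ε, Σ⁻¹A⟩₂ + ½ Q(A) − tr(Σ⁻¹ A Ĉ (Σ⁻¹ A₀)ᵀ)`. -/
noncomputable def Lfun {d : ℕ} (S C ε A₀ A : Matrix (Fin d) (Fin d) ℝ) : ℝ :=
  minner ε (S⁻¹ * A) + (1 / 2) * Qform S C A
    - Matrix.trace (S⁻¹ * A * C * (S⁻¹ * A₀)ᵀ)

noncomputable def slw (N : ℕ) (j : Fin N) : ℝ :=
  Real.sqrt (Real.log (2 * N / (j.1 + 1)))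

lemma slw_nonneg (N : ℕ) (j : Fin N) : 0 ≤ slw N j := Real.sqrt_nonneg _

lemma slw_antitone (N : ℕ) : Antitone (slw N) := by
  intro i j hij
  unfold slw
  have hN : (0 : ℝ) < N := by exact_mod_cast i.pos
  have h : (i.1 : ℝ) ≤ j.1 := by exact_mod_cast hij
  apply Real.sqrt_le_sqrt
  apply Real.log_le_log
  · positivity
  · gcongr

lemma slopeNorm_eq {N : ℕ} (b : Fin N → ℝ) :
    slopeNorm b = ∑ j, slw N j * sortDesc b j := rfl

noncomputable def sperm {N : ℕ} (b : Fin N → ℝ) : Equiv.Perm (Fin N) :=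
  Fin.revPerm.trans (Tuple.sort (fun i => |b i|))

lemma sortDesc_eq {N : ℕ} (b : Fin N → ℝ) (j : Fin N) :
    sortDesc b j = |b (sperm b j)| := rfl

lemma sortDesc_nonneg {N : ℕ} (b : Fin N → ℝ) (j : Fin N) : 0 ≤ sortDesc b j := abs_nonneg _

lemma sortDesc_antitone {N : ℕ} (b : Fin N → ℝ) : Antitone (sortDesc b) := by
  intro i j hij
  have h := Tuple.monotone_sort (fun i => |b i|)
  exact h (Fin.rev_le_rev.mpr hij)

lemma rearr {N : ℕ} (b v : Fin N → ℝ) (hv : Antitone v) (σ : Equiv.Perm (Fin N)) :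
    ∑ j, v j * |b (σ j)| ≤ ∑ j, v j * sortDesc b j := by
  have h := (hv.monovary (sortDesc_antitone b)).sum_mul_comp_perm_le_sum_mul
    (σ := σ.trans (sperm b).symm)
  refine le_trans (le_of_eq ?_) h
  simp [sortDesc_eq]

lemma rearr' {N : ℕ} (b : Fin N → ℝ) (v : Fin N → ℝ) (hv : Antitone v) (σ : Equiv.Perm (Fin N))
    (hb : Antitone (fun j => |b (σ j)|)) :
    ∑ j, v j * sortDesc b j ≤ ∑ j, v j * |b (σ j)| := by
  have h := (hv.monovary hb).sum_mul_comp_perm_le_sum_mul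
    (σ := (sperm b).trans σ.symm)
  refine le_trans (le_of_eq ?_) h
  simp [sortDesc_eq]

lemma slope_convex {N : ℕ} (x y : Fin N → ℝ) (p q : ℝ) (hp : 0 ≤ p) (hq : 0 ≤ q) :
    slopeNorm (fun k => p * x k + q * y k) ≤ p * slopeNorm x + q * slopeNorm y := by
  have h1 := rearr x (slw N) (slw_antitone N) (sperm (fun k => p * x k + q * y k))
  have h2 := rearr y (slw N) (slw_antitone N) (sperm (fun k => p * x k + q * y k))
  rw [slopeNorm_eq, slopeNorm_eq, slopeNorm_eq]
  refine le_trans ?_ (add_le_add (mul_le_mul_of_nonneg_left h1 hp) (mul_le_mul_of_nonneg_left h2 hq))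
  rw [Finset.mul_sum, Finset.mul_sum, ← Finset.sum_add_distrib]
  refine Finset.sum_le_sum fun j _ => ?_
  rw [sortDesc_eq]
  set m := sperm (fun k => p * x k + q * y k) j
  have h3 : |p * x m + q * y m| ≤ p * |x m| + q * |y m| := by
    refine (abs_add_le _ _).trans (le_of_eq ?_)
    rw [abs_mul, abs_mul, abs_of_nonneg hp, abs_of_nonneg hq]
  calc _ ≤ slw N j * (p * |x m| + q * |y m|) := mul_le_mul_of_nonneg_left h3 (slw_nonneg N j)
    _ = _ := by ring

lemma tail_ge {N : ℕ} (h : Fin N → ℝ) (σ : Equiv.Perm (Fin N)) (j : Fin N)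
    (hj : ∀ l, j ≤ l → |h (σ l)| ≤ |h (σ j)|) : sortDesc h j ≤ |h (σ j)| := by
  by_contra hc
  push Not at hc
  have hd : Disjoint ((Finset.Ici j).map σ.toEmbedding)
      ((Finset.Iic j).map (sperm h).toEmbedding) := by
    rw [Finset.disjoint_left]
    intro a ha hb
    simp only [Finset.mem_map, Finset.mem_Ici, Finset.mem_Iic] at ha hb
    obtain ⟨l, hl, rfl⟩ := ha
    obtain ⟨m, hm, he⟩ := hb
    have h1 := hj l hl
    have h2 := sortDesc_antitone h hm
    rw [sortDesc_eq h m] at h2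
    have he' : sperm h m = σ l := he
    rw [he'] at h2
    linarith
  have hcard := Finset.card_le_univ (((Finset.Ici j).map σ.toEmbedding) ∪
      ((Finset.Iic j).map (sperm h).toEmbedding))
  rw [Finset.card_union_of_disjoint hd] at hcard
  simp at hcard
  have := j.2
  omega

open Classical in
lemma slope_key {N : ℕ} (b h : Fin N → ℝ) (s : ℕ)
    (hs : (Finset.univ.filter (fun k => b k ≠ 0)).card ≤ s) :
    slopeNorm h + slopeNorm b - slopeNorm (fun k => b k + h k) ≤
      2 * ∑ j : Fin N, (if j.1 < s then slw N j else 0) * sortDesc h j := by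
  set key : Fin N → ℝ ×ₗ ℝ := fun i => toLex (-|b i|, -|h i|) with hkey
  set φ := Tuple.sort key with hφ
  have hmono : ∀ i j, i ≤ j → |b (φ j)| < |b (φ i)| ∨
      (|b (φ i)| = |b (φ j)| ∧ |h (φ j)| ≤ |h (φ i)|) := by
    intro i j hij
    have := Tuple.monotone_sort key hij
    simp only [hkey, Function.comp, Prod.Lex.toLex_le_toLex, neg_lt_neg_iff, neg_inj,
      neg_le_neg_iff] at this
    exact this
  have hb : Antitone (fun j => |b (φ j)|) := by
    intro i j hij
    rcases hmono i j hij with h | h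
    · exact h.le
    · exact h.1.ge
  have hz : ∀ j : Fin N, s ≤ j.1 → b (φ j) = 0 := by
    intro j hj
    by_contra hne
    have : (Finset.Iic j).map φ.toEmbedding ⊆ Finset.univ.filter (fun k => b k ≠ 0) := by
      intro a ha
      simp only [Finset.mem_map, Finset.mem_Iic] at ha
      obtain ⟨l, hl, rfl⟩ := ha
      simp only [Finset.mem_filter, Finset.mem_univ, true_and]
      have h1 : |b (φ j)| ≤ |b (φ l)| := hb hl
      have h2 : 0 < |b (φ j)| := abs_pos.mpr hne
      exact abs_pos.mp (lt_of_lt_of_le h2 h1)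
    have := Finset.card_le_card this
    simp at this
    simp at hs
    omega
  have htail : ∀ j : Fin N, s ≤ j.1 → sortDesc h j ≤ |h (φ j)| := by
    intro j hj
    apply tail_ge
    intro l hl
    rcases hmono j l hl with h | h
    · rw [hz j hj] at h
      simp at h
      exact absurd h (not_lt.mpr (abs_nonneg _))
    · exact h.2
  have hw' : Antitone (fun j : Fin N => if j.1 < s then slw N j else 0) := by
    intro i j hij
    have hij' : i.1 ≤ j.1 := hij
    have := slw_antitone N hij
    have := slw_nonneg N i
    dsimp only
    split_ifs <;> first | omega | linarith
  have e1 := rearr' b (slw N) (slw_antitone N) φ hb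
  have e2 := rearr (fun k => b k + h k) (slw N) (slw_antitone N) φ
  have e3 := rearr h _ hw' φ
  have e4 : ∑ j, slw N j * sortDesc h j + ∑ j, slw N j * |b (φ j)|
      ≤ ∑ j, slw N j * |b (φ j) + h (φ j)|
      + ∑ j : Fin N, (if j.1 < s then slw N j else 0) * |h (φ j)|
      + ∑ j : Fin N, (if j.1 < s then slw N j else 0) * sortDesc h j := by
    rw [← Finset.sum_add_distrib, ← Finset.sum_add_distrib, ← Finset.sum_add_distrib]
    refine Finset.sum_le_sum fun j _ => ?_
    have hw := slw_nonneg N j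
    by_cases hj : j.1 < s
    · simp only [if_pos hj]
      have : |b (φ j)| ≤ |b (φ j) + h (φ j)| + |h (φ j)| := by
        have := abs_sub (b (φ j) + h (φ j)) (h (φ j))
        simpa using this
      nlinarith [mul_le_mul_of_nonneg_left this hw]
    · simp only [if_neg hj]
      have h1 := hz j (not_lt.mp hj)
      have h2 := htail j (not_lt.mp hj)
      rw [h1]
      simp
      exact mul_le_mul_of_nonneg_left h2 hw
  simp only [slopeNorm_eq]
  linarith

lemma sum_log_le (N s : ℕ) (hs : 1 ≤ s) (hN : s ≤ N) :
    ∑ j ∈ Finset.range s, Real.log (2 * N / ((j : ℝ) + 1)) ≤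
      s * Real.log (2 * Real.exp 1 * N / s) := by
  have hN0 : (0 : ℝ) < N := by exact_mod_cast (by omega : 0 < N)
  have hs0 : (0 : ℝ) < s := by exact_mod_cast hs
  have h1 : ∀ n : ℕ, ∑ j ∈ Finset.range n, Real.log (2 * N / ((j : ℝ) + 1))
      = n * Real.log (2 * N) - Real.log n.factorial := by
    intro n
    induction n with
    | zero => simp
    | succ n ih =>
      rw [Finset.sum_range_succ, ih, Nat.factorial_succ, Real.log_div (by positivity) (by positivity)]
      push_cast
      rw [Real.log_mul (x := (n : ℝ) + 1) (by positivity) (by positivity)]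
      ring
  rw [h1]
  have h2 := Real.pow_div_factorial_le_exp (s : ℝ) hs0.le s
  have h3 := Real.log_le_log (by positivity) h2
  rw [Real.log_exp, Real.log_div (by positivity) (by positivity), Real.log_pow] at h3
  have h4 : Real.log (2 * Real.exp 1 * N / s) = Real.log (2 * N) + 1 - Real.log s := by
    rw [Real.log_div (by positivity) (by positivity), mul_right_comm,
      Real.log_mul (by positivity) (by positivity), Real.log_exp]
  rw [h4]
  nlinarith

lemma head_le {N : ℕ} (h : Fin N → ℝ) (s : ℕ) (hs : 1 ≤ s) (hN : s ≤ N) :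
    ∑ j : Fin N, (if j.1 < s then slw N j else 0) * sortDesc h j ≤
      Real.sqrt (s * Real.log (2 * Real.exp 1 * N / s)) * Real.sqrt (∑ k, h k ^ 2) := by
  refine (Real.sum_mul_le_sqrt_mul_sqrt _ _ _).trans ?_
  have h1 : ∑ j, sortDesc h j ^ 2 = ∑ k, h k ^ 2 := by
    simp only [sortDesc_eq, sq_abs]
    exact Equiv.sum_comp (sperm h) (fun k => h k ^ 2)
  rw [h1]
  refine mul_le_mul_of_nonneg_right (Real.sqrt_le_sqrt ?_) (Real.sqrt_nonneg _)
  refine le_trans (le_of_eq ?_) (sum_log_le N s hs hN)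
  have hN0 : (0 : ℝ) < N := by exact_mod_cast (by omega : 0 < N)
  have h2 : ∀ j : Fin N, (if j.1 < s then slw N j else 0) ^ 2
      = if j.1 < s then Real.log (2 * N / ((j.1 : ℝ) + 1)) else 0 := by
    intro j
    split_ifs
    · unfold slw
      rw [Real.sq_sqrt]
      apply Real.log_nonneg
      rw [le_div_iff₀ (by positivity)]
      have : ((j.1 : ℝ) + 1) ≤ N := by exact_mod_cast j.2
      linarith
    · simp
  simp only [h2]
  rw [Fin.sum_univ_eq_sum_range (fun j => if j < s then Real.log (2 * N / ((j : ℝ) + 1)) else 0) N,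
    ← Finset.sum_filter]
  congr 1
  ext j
  simp
  omega

/-- vectorization -/
def mvec {d : ℕ} (B : Matrix (Fin d) (Fin d) ℝ) (k : Fin (d * d)) : ℝ :=
  B (finProdFinEquiv.symm k).1 (finProdFinEquiv.symm k).2

lemma slopeNormM_eq {d : ℕ} (B : Matrix (Fin d) (Fin d) ℝ) : slopeNormM B = slopeNorm (mvec B) := rfl

lemma frob_eq {d : ℕ} (B : Matrix (Fin d) (Fin d) ℝ) :
    frobNorm B = Real.sqrt (∑ k, mvec B k ^ 2) := by
  unfold frobNorm mvec
  rw [Equiv.sum_comp finProdFinEquiv.symm (fun p : Fin d × Fin d => B p.1 p.2 ^ 2),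
    Fintype.sum_prod_type]

open Classical in
lemma l0_eq {d : ℕ} (B : Matrix (Fin d) (Fin d) ℝ) :
    (Finset.univ.filter (fun k => mvec B k ≠ 0)).card = l0Norm B := by
  unfold l0Norm
  refine Finset.card_bij (fun k _ => finProdFinEquiv.symm k) ?_ ?_ ?_
  · intro k hk
    simpa [mvec] using hk
  · intro a _ b _ hab
    exact finProdFinEquiv.symm.injective hab
  · intro p hp
    refine ⟨finProdFinEquiv p, ?_, by simp⟩
    have hp2 := (Finset.mem_filter.mp hp).2
    refine Finset.mem_filter.mpr ⟨Finset.mem_univ _, ?_⟩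
    unfold mvec
    rw [Equiv.symm_apply_apply]
    exact hp2

/-- the bilinear form -/
noncomputable def bilC {d : ℕ} (C X Y : Matrix (Fin d) (Fin d) ℝ) : ℝ := Matrix.trace (X * C * Yᵀ)

lemma bilC_symm {d : ℕ} (C X Y : Matrix (Fin d) (Fin d) ℝ) (hC : Cᵀ = C) :
    bilC C X Y = bilC C Y X := by
  unfold bilC
  rw [← Matrix.trace_transpose]
  simp [Matrix.transpose_mul, hC, Matrix.mul_assoc]
lemma bilC_add {d : ℕ} (C X Y Z : Matrix (Fin d) (Fin d) ℝ) :
    bilC C (X + Y) Z = bilC C X Z + bilC C Y Z := by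
  simp [bilC, Matrix.add_mul]
lemma bilC_sub {d : ℕ} (C X Y Z : Matrix (Fin d) (Fin d) ℝ) :
    bilC C (X - Y) Z = bilC C X Z - bilC C Y Z := by
  simp [bilC, Matrix.sub_mul]
lemma bilC_smul {d : ℕ} (C X Z : Matrix (Fin d) (Fin d) ℝ) (t : ℝ) :
    bilC C (t • X) Z = t * bilC C X Z := by
  simp [bilC]

/-- first-order consequence of minimality -/
lemma first_order (l q p : ℝ) (h : ∀ t : ℝ, 0 < t → t < 1 → 0 ≤ t * l + t ^ 2 * q + t * p) :
    0 ≤ l + p := by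
  by_contra hc
  push Not at hc
  set δ := -(l + p) with hδ
  have hδ0 : 0 < δ := by linarith
  have hden : 0 < 2 * (|q| + δ) := by positivity
  set t := δ / (2 * (|q| + δ)) with ht
  have ht0 : 0 < t := by positivity
  have ht1 : t < 1 := by
    rw [ht, div_lt_one hden]
    linarith [abs_nonneg q]
  have h1 := h t ht0 ht1
  have h2 : 0 ≤ l + t * q + p := by
    have : 0 ≤ t * (l + t * q + p) := by nlinarith
    exact nonneg_of_mul_nonneg_right this ht0
  have h3 : t * q ≤ t * |q| := mul_le_mul_of_nonneg_left (le_abs_self q) ht0.le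
  have h4 : t * (2 * (|q| + δ)) = δ := by rw [ht]; field_simp
  nlinarith [mul_pos ht0 hδ0, mul_nonneg ht0.le (abs_nonneg q)]

lemma final_arith (lam κ r g x H D E qh : ℝ) (hl : 0 ≤ lam) (hκ : 0 < κ) (hr : 0 ≤ r) (hg : 0 ≤ g)
    (hx : 0 ≤ x) (h1 : H + D ≤ 2 * (r * x)) (h2 : D ≤ H)
    (hE : E ≤ lam * max H (g * x)) (hq : κ / 2 * x ^ 2 ≤ qh) :
    2 * lam * H + 2 * E + 4 * lam * D - qh ≤ 32 * lam ^ 2 / κ * max (r ^ 2) (g ^ 2) := by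
  set M := max r g with hM
  have hM0 : 0 ≤ M := le_max_of_le_left hr
  have hM2 : M ^ 2 ≤ max (r ^ 2) (g ^ 2) := by
    rcases max_choice r g with h | h <;> rw [hM, h]
    · exact le_max_left _ _
    · exact le_max_right _ _
  have hrM : r * x ≤ M * x := mul_le_mul_of_nonneg_right (le_max_left _ _) hx
  have hgM : g * x ≤ M * x := mul_le_mul_of_nonneg_right (le_max_right _ _) hx
  have h3 : 2 * H + 2 * max H (g * x) + 4 * D ≤ 8 * (M * x) := by
    rcases le_total H (g * x) with h | h
    · rw [max_eq_right h]; linarith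
    · rw [max_eq_left h]; linarith
  have h4 := mul_le_mul_of_nonneg_left h3 hl
  have h5 : 8 * lam * M * x - κ / 2 * x ^ 2 ≤ 32 * lam ^ 2 / κ * M ^ 2 := by
    have : 32 * lam ^ 2 / κ * M ^ 2 - (8 * lam * M * x - κ / 2 * x ^ 2)
        = (8 * lam * M - κ * x) ^ 2 / (2 * κ) := by field_simp; ring
    have h6 : 0 ≤ (8 * lam * M - κ * x) ^ 2 / (2 * κ) := by positivity
    linarith
  have h7 : 32 * lam ^ 2 / κ * M ^ 2 ≤ 32 * lam ^ 2 / κ * max (r ^ 2) (g ^ 2) :=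
    mul_le_mul_of_nonneg_left hM2 (by positivity)
  nlinarith

/-- Deterministic core of the Slope oracle inequality (Proposition 3.4). -/
theorem slope_oracle_inequality {d : ℕ} (hd : 1 ≤ d)
    (T κmin κmax cstar ε₀ cS : ℝ)
    (hT : 0 < T) (hκmin : 0 < κmin) (hκmax : 0 < κmax) (hcstar : 0 < cstar)
    (hε₀ : ε₀ ∈ Set.Ioo (0 : ℝ) 1)
    (hcS : cstar * Real.sqrt κmax ≤ cS)
    (S C ε A₀ : Matrix (Fin d) (Fin d) ℝ)
    (hS : IsUnit S.det) (hC : C.PosSemidef)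
    (s : ℕ) (hsdef : s = l0Norm (S⁻¹ * A₀)) (hs1 : 1 ≤ s) (hs2 : s ≤ d ^ 2)
    (hRE : ∀ B : Matrix (Fin d) (Fin d) ℝ,
      κmin / 2 * (frobNorm B) ^ 2 ≤ Matrix.trace (B * C * Bᵀ))
    (hSE : ∀ B : Matrix (Fin d) (Fin d) ℝ,
      minner ε B ≤ cstar * Real.sqrt (κmax / T) *
        max (slopeNormM B) (Real.sqrt (Real.log (4 / ε₀)) * frobNorm B))
    (Ahat : Matrix (Fin d) (Fin d) ℝ)
    (hmin : ∀ A : Matrix (Fin d) (Fin d) ℝ,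
      Lfun S C ε A₀ Ahat + 2 * cS / Real.sqrt T * slopeNormM (S⁻¹ * Ahat) ≤
        Lfun S C ε A₀ A + 2 * cS / Real.sqrt T * slopeNormM (S⁻¹ * A)) :
    ∀ A : Matrix (Fin d) (Fin d) ℝ, l0Norm (S⁻¹ * A) ≤ s →
      Qform S C (Ahat - A₀) + 2 * cS / Real.sqrt T * slopeNormM (S⁻¹ * (Ahat - A)) ≤
        Qform S C (A - A₀) +
          32 * cS ^ 2 * s * Real.log (2 * Real.exp 1 * d ^ 2 / s) / (T * κmin) *
            max 1 (Real.log (4 / ε₀) / (s * Real.log (2 * Real.exp 1 * d ^ 2 / s))) := by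
  intro A hA
  have hCt : Cᵀ = C := by
    have := hC.1
    simpa [Matrix.IsHermitian, Matrix.conjTranspose_eq_transpose_of_trivial] using this
  set a := S⁻¹ * Ahat with ha
  set b := S⁻¹ * A with hb
  set a0 := S⁻¹ * A₀ with ha0
  have hsq : 0 < Real.sqrt T := Real.sqrt_pos.mpr hT
  have hcS0 : 0 ≤ cS := le_trans (by positivity) hcS
  set lam := cS / Real.sqrt T with hlam
  have hlam0 : 0 ≤ lam := by positivity
  have hlam2 : 2 * cS / Real.sqrt T = 2 * lam := by rw [hlam]; ring
  rw [hlam2] at hmin ⊢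
  have hLf : ∀ X, Lfun S C ε A₀ X = minner ε (S⁻¹ * X) + 1 / 2 * bilC C (S⁻¹ * X) (S⁻¹ * X)
      - bilC C (S⁻¹ * X) a0 := fun X => rfl
  have hQf : ∀ X, Qform S C X = bilC C (S⁻¹ * X) (S⁻¹ * X) := fun X => rfl
  -- first-order condition
  have hfo : 0 ≤ (minner ε (b - a) + bilC C (b - a) (a - a0))
      + 2 * lam * (slopeNormM b - slopeNormM a) := by
    apply first_order _ (1 / 2 * bilC C (b - a) (b - a))
    intro t ht0 ht1
    have hm := hmin (Ahat + t • (A - Ahat))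
    have hX : S⁻¹ * (Ahat + t • (A - Ahat)) = a + t • (b - a) := by
      rw [Matrix.mul_add, Matrix.mul_smul, Matrix.mul_sub]
    have hconv : slopeNormM (a + t • (b - a)) ≤ (1 - t) * slopeNormM a + t * slopeNormM b := by
      have := slope_convex (mvec a) (mvec b) (1 - t) t (by linarith) ht0.le
      refine le_trans (le_of_eq ?_) this
      rw [slopeNormM_eq]
      congr 1
      funext k
      simp [mvec]
      ring
    rw [hLf, hLf, hX, ← ha] at hm
    have hin : minner ε (a + t • (b - a)) = minner ε a + t * minner ε (b - a) := by
      simp [minner, Matrix.mul_add]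
    have e1 : bilC C (a + t • (b - a)) (a + t • (b - a)) = bilC C a a + 2 * t * bilC C (b - a) a
        + t ^ 2 * bilC C (b - a) (b - a) := by
      rw [bilC_add, bilC_smul, bilC_symm C a _ hCt, bilC_symm C (b - a) (_ + _) hCt, bilC_add,
        bilC_add, bilC_smul, bilC_smul, bilC_symm C a (b - a) hCt]
      ring
    have e2 : bilC C (a + t • (b - a)) a0 = bilC C a a0 + t * bilC C (b - a) a0 := by
      rw [bilC_add, bilC_smul]
    have e3 : bilC C (b - a) (a - a0) = bilC C (b - a) a - bilC C (b - a) a0 := by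
      rw [bilC_symm C _ _ hCt, bilC_sub, bilC_symm C a _ hCt, bilC_symm C a0 _ hCt]
    rw [hin, e1, e2] at hm
    rw [e3]
    have := mul_le_mul_of_nonneg_left hconv (by positivity : 0 ≤ 2 * lam)
    linarith
  have hQ1 : Qform S C (Ahat - A₀) = bilC C (a - a0) (a - a0) := by
    rw [hQf, Matrix.mul_sub]
  have hQ2 : Qform S C (A - A₀) = bilC C (a - a0) (a - a0) + 2 * bilC C (b - a) (a - a0)
      + bilC C (b - a) (b - a) := by
    rw [hQf, Matrix.mul_sub, ← hb, ← ha0]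
    have : b - a0 = (a - a0) + (b - a) := by abel
    rw [this, bilC_add, bilC_symm C (a - a0) (_ + _) hCt, bilC_symm C (b - a) (_ + _) hCt, bilC_add,
      bilC_add, bilC_symm C (a - a0) (b - a) hCt]
    ring
  have hneg : slopeNormM (S⁻¹ * (Ahat - A)) = slopeNormM (b - a) := by
    rw [Matrix.mul_sub, ← ha, ← hb, slopeNormM_eq, slopeNormM_eq]
    have : mvec (a - b) = fun k => - mvec (b - a) k := by
      funext k; simp [mvec]
    rw [this]
    simp [slopeNorm, sortDesc]
  have hneg' : slopeNormM (a - b) = slopeNormM (b - a) := by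
    rw [← hneg, Matrix.mul_sub]
  have hfneg : frobNorm (a - b) = frobNorm (b - a) := by
    unfold frobNorm
    congr 1
    refine Finset.sum_congr rfl fun i _ => Finset.sum_congr rfl fun j _ => ?_
    simp only [Matrix.sub_apply]
    ring
  have hsN : s ≤ d * d := by rw [← pow_two]; exact hs2
  have hs0 : (0 : ℝ) < s := by exact_mod_cast hs1
  have hdd : ((d * d : ℕ) : ℝ) = (d : ℝ) ^ 2 := by push_cast; ring
  set ℓ := Real.log (2 * Real.exp 1 * d ^ 2 / s) with hℓ
  have hℓ0 : 0 < ℓ := by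
    apply Real.log_pos
    rw [lt_div_iff₀ hs0]
    have h1 : (s : ℝ) ≤ (d : ℝ) ^ 2 := by exact_mod_cast hs2
    have h2 : (1 : ℝ) < Real.exp 1 := by simp
    nlinarith
  -- the sparse inequality
  have hk1 : slopeNormM (b - a) + (slopeNormM b - slopeNormM a)
      ≤ 2 * (Real.sqrt (s * ℓ) * frobNorm (b - a)) := by
    classical
    have k1 := slope_key (mvec b) (mvec (a - b)) s (by rw [l0_eq]; exact hA)
    have k2 := head_le (mvec (a - b)) s hs1 hsN
    rw [← frob_eq, hfneg, hdd] at k2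
    have k3 : (fun k => mvec b k + mvec (a - b) k) = mvec a := by
      funext k; simp [mvec]
    rw [k3, ← slopeNormM_eq, ← slopeNormM_eq, ← slopeNormM_eq, hneg'] at k1
    linarith
  have hk2 : slopeNormM b - slopeNormM a ≤ slopeNormM (b - a) := by
    have := slope_convex (mvec a) (mvec (b - a)) 1 1 zero_le_one zero_le_one
    have k3 : (fun k => 1 * mvec a k + 1 * mvec (b - a) k) = mvec b := by
      funext k; simp [mvec]
    rw [k3, ← slopeNormM_eq, ← slopeNormM_eq, ← slopeNormM_eq] at this
    linarith
  have hx0 : 0 ≤ frobNorm (b - a) := Real.sqrt_nonneg _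
  have hG0 : 0 ≤ Real.log (4 / ε₀) := by
    apply Real.log_nonneg
    rw [le_div_iff₀ hε₀.1]
    linarith [hε₀.2]
  have hE : minner ε (b - a) ≤ lam * max (slopeNormM (b - a))
      (Real.sqrt (Real.log (4 / ε₀)) * frobNorm (b - a)) := by
    refine (hSE (b - a)).trans ?_
    refine mul_le_mul_of_nonneg_right ?_ (le_max_of_le_right (by positivity))
    rw [Real.sqrt_div hκmax.le, hlam, ← mul_div_assoc]
    gcongr
  have hfin := final_arith lam κmin (Real.sqrt (s * ℓ)) (Real.sqrt (Real.log (4 / ε₀)))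
    (frobNorm (b - a)) (slopeNormM (b - a)) (slopeNormM b - slopeNormM a) (minner ε (b - a))
    (bilC C (b - a) (b - a)) hlam0 hκmin (Real.sqrt_nonneg _) (Real.sqrt_nonneg _) hx0 hk1 hk2 hE
    (hRE (b - a))
  rw [Real.sq_sqrt (by positivity), Real.sq_sqrt hG0] at hfin
  have hR : 32 * cS ^ 2 * s * ℓ / (T * κmin) * max 1 (Real.log (4 / ε₀) / (s * ℓ))
      = 32 * lam ^ 2 / κmin * max (s * ℓ) (Real.log (4 / ε₀)) := by
    have h1 : max (s * ℓ) (Real.log (4 / ε₀)) = s * ℓ * max 1 (Real.log (4 / ε₀) / (s * ℓ)) := by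
      rw [mul_max_of_nonneg _ _ (by positivity : 0 ≤ s * ℓ)]
      congr 1
      · ring
      · field_simp
    have h2 : lam ^ 2 = cS ^ 2 / T := by rw [hlam, div_pow, Real.sq_sqrt hT.le]
    rw [h1, h2]
    field_simp
  rw [hR, hQ1, hQ2, hneg]
  linarith
end

section
/- For every N ≥ 1, every b ∈ ℝ^N, and every integer s with 1 ≤ s ≤ N, the Slope norm satisfies the splitting inequality ‖b‖_* ≤ √(log(2eN/s)) · ( √s · ‖b‖₂ + Σ_{j=s+1}^{N} b#_j ), where ‖b‖₂ is the Euclidean norm. -/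
open Finset

lemma sum_log_aux (L : ℝ) (s : ℕ) :
    ∑ i ∈ Finset.range s, (L - Real.log ((i : ℝ) + 1)) ≤ s * (L + 1 - Real.log s) := by
  induction s with
  | zero => simp
  | succ s ih =>
    rw [Finset.sum_range_succ]
    push_cast
    have key : (s : ℝ) * (Real.log ((s : ℝ) + 1) - Real.log s) ≤ 1 := by
      rcases Nat.eq_zero_or_pos s with h | h
      · subst h; simp
      · have hs : (0 : ℝ) < s := by exact_mod_cast h
        rw [← Real.log_div (by positivity) hs.ne']
        have h1 := Real.log_le_sub_one_of_pos (show (0 : ℝ) < ((s : ℝ) + 1) / s by positivity)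
        calc (s : ℝ) * Real.log (((s : ℝ) + 1) / s) ≤ s * (((s : ℝ) + 1) / s - 1) := by gcongr
          _ = 1 := by field_simp; ring
    nlinarith

lemma sum_sortDesc_sq {N : ℕ} (b : Fin N → ℝ) : ∑ j, (sortDesc b j) ^ 2 = ∑ j, (b j) ^ 2 := by
  simp only [sortDesc, sq_abs]
  exact Equiv.sum_comp (Fin.revPerm.trans (Tuple.sort (fun i => |b i|))) (fun j => (b j) ^ 2)

lemma sum_filter_lt_aux {N s : ℕ} (hs : s ≤ N) (f : ℕ → ℝ) :
    ∑ j ∈ Finset.univ.filter (fun j : Fin N => j.1 < s), f j.1 = ∑ i ∈ Finset.range s, f i := by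
  rw [Finset.sum_filter, Fin.sum_univ_eq_sum_range (fun i => if i < s then f i else 0) N,
    ← Finset.sum_filter]
  congr 1
  ext i
  simp only [Finset.mem_filter, Finset.mem_range]
  omega

/-- Splitting inequality for the Slope norm (display (eq: G F)). -/
theorem slopeNorm_splitting {N : ℕ} (hN : 1 ≤ N) (b : Fin N → ℝ)
    (s : ℕ) (hs1 : 1 ≤ s) (hs2 : s ≤ N) :
    slopeNorm b ≤ Real.sqrt (Real.log (2 * Real.exp 1 * N / s)) *
      (Real.sqrt s * Real.sqrt (∑ j, (b j) ^ 2) +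
        ∑ j ∈ Finset.univ.filter (fun j : Fin N => s ≤ j.1), sortDesc b j) := by
  have hN0 : (0 : ℝ) < N := by exact_mod_cast hN
  have hs0 : (0 : ℝ) < s := by exact_mod_cast hs1
  have hlog : Real.log (2 * Real.exp 1 * N / s) = Real.log (2 * N) + 1 - Real.log s := by
    rw [Real.log_div (by positivity) hs0.ne',
      show 2 * Real.exp 1 * (N : ℝ) = (2 * N) * Real.exp 1 by ring,
      Real.log_mul (by positivity) (by positivity), Real.log_exp]
  have hnn : ∀ j : Fin N, 0 ≤ sortDesc b j := fun j => abs_nonneg _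
  have hl0 : ∀ j : Fin N, 0 ≤ Real.log (2 * N / ((j.1 : ℝ) + 1)) := by
    intro j
    apply Real.log_nonneg
    have hj : (j.1 : ℝ) + 1 ≤ N := by exact_mod_cast j.2
    rw [le_div_iff₀ (by positivity)]
    linarith
  unfold slopeNorm
  rw [← Finset.sum_filter_add_sum_filter_not Finset.univ (fun j : Fin N => j.1 < s), mul_add]
  apply add_le_add
  · refine (Real.sum_mul_le_sqrt_mul_sqrt _ _ _).trans ?_
    rw [← mul_assoc, ← Real.sqrt_mul' _ hs0.le]
    gcongr ?_ * ?_
    · apply Real.sqrt_le_sqrt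
      rw [Finset.sum_congr rfl (fun j _ => Real.sq_sqrt (hl0 j)),
        sum_filter_lt_aux hs2 (fun i => Real.log (2 * N / ((i : ℝ) + 1))), hlog, mul_comm _ (s : ℝ)]
      refine le_trans (le_of_eq ?_) (sum_log_aux (Real.log (2 * N)) s)
      refine Finset.sum_congr rfl (fun i _ => ?_)
      rw [Real.log_div (by positivity) (by positivity)]
    · apply Real.sqrt_le_sqrt
      rw [← sum_sortDesc_sq b]
      exact Finset.sum_le_sum_of_subset_of_nonneg (Finset.filter_subset _ _)
        (fun _ _ _ => sq_nonneg _)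
  · rw [Finset.mul_sum]
    simp only [not_lt]
    refine Finset.sum_le_sum (fun j hj => ?_)
    have hj' : s ≤ j.1 := (Finset.mem_filter.mp hj).2
    have hj2 : (s : ℝ) ≤ j.1 := by exact_mod_cast hj'
    refine mul_le_mul_of_nonneg_right (Real.sqrt_le_sqrt ?_) (hnn j)
    rw [hlog, Real.log_div (by positivity) (by positivity)]
    have := Real.log_le_log hs0 (show (s : ℝ) ≤ (j.1 : ℝ) + 1 by linarith)
    linarith
end
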